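/- Algebraic form of the main theorem: let n ≥ 0, let g₁, …, gₙ each be an arbitrary product of the matrices α, β, γ and their inverses, let T₁, …, Tₙ each be one of the eleven tile boundary matrices B₁, B₂, B₃, S₁, S₂, N₁, …, N₆ or an inverse of one of them. Then the product (g₁·T₁·g₁⁻¹)·(g₂·T₂·g₂⁻¹)·⋯·(gₙ·Tₙ·gₙ⁻¹) equals I or −I. Consequently every element of the smallest normal subgroup of the connection group ⟨α, β, γ⟩ containing the tile boundary matrices is ±I, so if a region R has a signed tiling by stones, bones, and snakes, the connection-matrix product along ∂R is ±I. -/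

import Mathlib

open Matrix

/-- `ω = exp(2πi/12)`, a primitive 12th root of unity. -/
noncomputable def ω : ℂ := Complex.exp (2 * Real.pi * Complex.I / 12)

/-- The SL₂(ℂ) connection matrix on northeast edges. -/
noncomputable def α : Matrix (Fin 2) (Fin 2) ℂ := !![ω^7, 0; 0, ω^5]

/-- The SL₂(ℂ) connection matrix on northwest edges. -/
noncomputable def β : Matrix (Fin 2) (Fin 2) ℂ := !![ω^7, ω^3; 0, ω^5]

/-- The SL₂(ℂ) connection matrix on horizontal edges. -/
noncomputable def γ : Matrix (Fin 2) (Fin 2) ℂ := !![ω^5, 0; ω^3, ω^7]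

/-- The length-two move `X = β·α`. -/
noncomputable def X : Matrix (Fin 2) (Fin 2) ℂ := β * α

/-- The length-two move `Y = α⁻¹·γ`. -/
noncomputable def Y : Matrix (Fin 2) (Fin 2) ℂ := α⁻¹ * γ

/-- The length-two move `Z = γ⁻¹·β⁻¹`. -/
noncomputable def Z : Matrix (Fin 2) (Fin 2) ℂ := γ⁻¹ * β⁻¹

/-- `x = X⁻¹`. -/
noncomputable def x : Matrix (Fin 2) (Fin 2) ℂ := X⁻¹

/-- `y = Y⁻¹`. -/
noncomputable def y : Matrix (Fin 2) (Fin 2) ℂ := Y⁻¹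

/-- `z = Z⁻¹`. -/
noncomputable def z : Matrix (Fin 2) (Fin 2) ℂ := Z⁻¹

/-- Bone boundary word `B₁ = Z·Z·Z·Y·z·z·X`. -/
noncomputable def B₁ : Matrix (Fin 2) (Fin 2) ℂ := Z * Z * Z * Y * z * z * X

/-- Bone boundary word `B₂ = Z·x·x·Y·X·X·X`. -/
noncomputable def B₂ : Matrix (Fin 2) (Fin 2) ℂ := Z * x * x * Y * X * X * X

/-- Bone boundary word `B₃ = Z·Y·Y·Y·X·y·y`. -/
noncomputable def B₃ : Matrix (Fin 2) (Fin 2) ℂ := Z * Y * Y * Y * X * y * y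

/-- Stone boundary word `S₁ = Z·Z·Y·Y·X·X`. -/
noncomputable def S₁ : Matrix (Fin 2) (Fin 2) ℂ := Z * Z * Y * Y * X * X

/-- Stone boundary word `S₂ = y·Z·x·Y·z·X`. -/
noncomputable def S₂ : Matrix (Fin 2) (Fin 2) ℂ := y * Z * x * Y * z * X

/-- Snake boundary word `N₁ = Z·y·Z·Z·Y·z·Y·z·X`. -/
noncomputable def N₁ : Matrix (Fin 2) (Fin 2) ℂ := Z * y * Z * Z * Y * z * Y * z * X

/-- Snake boundary word `N₂ = Z·x·Z·x·Y·X·z·X·X`. -/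
noncomputable def N₂ : Matrix (Fin 2) (Fin 2) ℂ := Z * x * Z * x * Y * X * z * X * X

/-- Snake boundary word `N₃ = y·Z·y·Z·Y·Y·z·Y·X`. -/
noncomputable def N₃ : Matrix (Fin 2) (Fin 2) ℂ := y * Z * y * Z * Y * Y * z * Y * X

/-- Snake boundary word `N₄ = Z·Z·x·Z·Y·z·X·z·X`. -/
noncomputable def N₄ : Matrix (Fin 2) (Fin 2) ℂ := Z * Z * x * Z * Y * z * X * z * X

/-- Snake boundary word `N₅ = Z·x·Y·x·Y·X·X·y·X`. -/
noncomputable def N₅ : Matrix (Fin 2) (Fin 2) ℂ := Z * x * Y * x * Y * X * X * y * X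

/-- Snake boundary word `N₆ = y·Z·Y·x·Y·Y·X·y·X`. -/
noncomputable def N₆ : Matrix (Fin 2) (Fin 2) ℂ := y * Z * Y * x * Y * Y * X * y * X

/-- The eleven tile boundary matrices: three bones, two stones, six snakes. -/
noncomputable def tileBoundaries : Set (Matrix (Fin 2) (Fin 2) ℂ) :=
  {B₁, B₂, B₃, S₁, S₂, N₁, N₂, N₃, N₄, N₅, N₆}

/-- The nine bone and snake boundary matrices. -/
noncomputable def boneSnakeBoundaries : Set (Matrix (Fin 2) (Fin 2) ℂ) :=
  {B₁, B₂, B₃, N₁, N₂, N₃, N₄, N₅, N₆}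

lemma omega_pow_four : ω ^ 4 = ω ^ 2 - 1 := by
  have h6 : ω ^ 6 = -1 := by
    rw [ω, ← Complex.exp_nat_mul, ← Complex.exp_pi_mul_I]
    congr 1
    push_cast
    ring
  have h2 : ω ^ 2 + 1 ≠ 0 := by
    have h : ω ^ 2 = Complex.exp ((Real.pi / 3 : ℝ) * Complex.I) := by
      rw [ω, ← Complex.exp_nat_mul]
      congr 1
      push_cast
      ring
    intro h0
    have hre := congrArg Complex.re h0
    rw [h, Complex.add_re, Complex.exp_ofReal_mul_I_re, Real.cos_pi_div_three] at hre
    norm_num at hre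
  refine mul_left_cancel₀ h2 ?_
  linear_combination h6

lemma det_alpha : α.det = 1 := by
  have h := omega_pow_four
  rw [α, det_fin_two_of]
  grind

lemma det_beta : β.det = 1 := by
  have h := omega_pow_four
  rw [β, det_fin_two_of]
  grind

lemma det_gamma : γ.det = 1 := by
  have h := omega_pow_four
  rw [γ, det_fin_two_of]
  grind

lemma inv_eq_adjugate_of_det_eq_one {n R : Type*} [Fintype n] [DecidableEq n] [CommRing R]
    {A : Matrix n n R} (h : A.det = 1) : A⁻¹ = A.adjugate := by
  rw [inv_def, h, Ring.inverse_one, one_smul]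

lemma fin_two_of_congr {R : Type*} {a b c d a' b' c' d' : R} (ha : a = a') (hb : b = b')
    (hc : c = c') (hd : d = d') : !![a, b; c, d] = !![a', b'; c', d'] := by
  rw [ha, hb, hc, hd]

lemma X_eq : X = !![ω ^ 2, -ω ^ 2; 0, 1 - ω ^ 2] := by
  have h := omega_pow_four
  rw [X, α, β, mul_fin_two]
  apply fin_two_of_congr <;> grind

lemma Y_eq : Y = !![1 - ω ^ 2, 0; 1 - ω ^ 2, ω ^ 2] := by
  have h := omega_pow_four
  rw [Y, inv_eq_adjugate_of_det_eq_one det_alpha, α, γ, adjugate_fin_two_of, mul_fin_two]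
  apply fin_two_of_congr <;> grind

lemma Z_eq : Z = !![1, ω ^ 2 - 1; ω ^ 2, 0] := by
  have h := omega_pow_four
  rw [Z, inv_eq_adjugate_of_det_eq_one det_beta, inv_eq_adjugate_of_det_eq_one det_gamma, β, γ,
    adjugate_fin_two_of, adjugate_fin_two_of, mul_fin_two]
  apply fin_two_of_congr <;> grind

lemma x_eq : x = !![1 - ω ^ 2, ω ^ 2; 0, ω ^ 2] := by
  have h := omega_pow_four
  rw [x, inv_eq_adjugate_of_det_eq_one, X_eq, adjugate_fin_two_of, neg_neg, neg_zero]
  rw [X_eq, det_fin_two_of]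
  grind

lemma y_eq : y = !![ω ^ 2, 0; ω ^ 2 - 1, 1 - ω ^ 2] := by
  have h := omega_pow_four
  rw [y, inv_eq_adjugate_of_det_eq_one, Y_eq, adjugate_fin_two_of, neg_sub, neg_zero]
  rw [Y_eq, det_fin_two_of]
  grind

lemma z_eq : z = !![0, 1 - ω ^ 2; -ω ^ 2, 1] := by
  have h := omega_pow_four
  rw [z, inv_eq_adjugate_of_det_eq_one, Z_eq, adjugate_fin_two_of, neg_sub]
  rw [Z_eq, det_fin_two_of]
  grind

lemma tile_boundary_eq_one_or_neg_one {t : Matrix (Fin 2) (Fin 2) ℂ} (ht : t ∈ tileBoundaries) :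
    t = 1 ∨ t = -1 := by
  have h := omega_pow_four
  have hneg : (-1 : Matrix (Fin 2) (Fin 2) ℂ) = !![-1, 0; 0, -1] := by
    simp [one_fin_two]
  rcases ht with rfl | rfl | rfl | rfl | rfl | rfl | rfl | rfl | rfl | rfl | rfl
  case inr.inr.inr.inl | inr.inr.inr.inr.inl =>
    right
    simp only [S₁, S₂, X_eq, Y_eq, Z_eq, x_eq, y_eq, z_eq, mul_fin_two, hneg]
    apply fin_two_of_congr <;> grind
  all_goals
    left
    simp only [B₁, B₂, B₃, N₁, N₂, N₃, N₄, N₅, N₆, X_eq, Y_eq, Z_eq, x_eq, y_eq, z_eq,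
      mul_fin_two, one_fin_two]
    apply fin_two_of_congr <;> grind

lemma isUnit_det_of_mem_closure {g : Matrix (Fin 2) (Fin 2) ℂ}
    (hg : g ∈ Submonoid.closure
      ({α, β, γ, α⁻¹, β⁻¹, γ⁻¹} : Set (Matrix (Fin 2) (Fin 2) ℂ))) : IsUnit g.det := by
  induction hg using Submonoid.closure_induction with
  | mem a ha =>
    rcases ha with rfl | rfl | rfl | rfl | rfl | rfl <;>
      simp [det_nonsing_inv, det_alpha, det_beta, det_gamma]
  | one => simp
  | mul a b _ _ ha hb => rw [det_mul]; exact ha.mul hb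

lemma list_prod_eq_one_or_neg_one {M : Type*} [Monoid M] [HasDistribNeg M] {l : List M}
    (hl : ∀ a ∈ l, a = 1 ∨ a = -1) : l.prod = 1 ∨ l.prod = -1 := by
  induction l with
  | nil => simp
  | cons a l ih =>
    rw [List.forall_mem_cons] at hl
    rcases hl.1 with rfl | rfl <;> rcases ih hl.2 with h | h <;> simp [h]

/-- Main theorem, algebraic form: any product of conjugates (by words in α, β, γ and
their inverses) of tile boundary matrices or their inverses is `I` or `-I`. -/
theorem signed_tiling_boundary_pm_one (n : ℕ)
    (g T : Fin n → Matrix (Fin 2) (Fin 2) ℂ)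
    (hg : ∀ i, g i ∈ Submonoid.closure
      ({α, β, γ, α⁻¹, β⁻¹, γ⁻¹} : Set (Matrix (Fin 2) (Fin 2) ℂ)))
    (hT : ∀ i, T i ∈ tileBoundaries ∨ ∃ t ∈ tileBoundaries, T i = t⁻¹) :
    (List.ofFn fun i => g i * T i * (g i)⁻¹).prod = (1 : Matrix (Fin 2) (Fin 2) ℂ) ∨
    (List.ofFn fun i => g i * T i * (g i)⁻¹).prod = -(1 : Matrix (Fin 2) (Fin 2) ℂ) := by
  have hinv : (-1 : Matrix (Fin 2) (Fin 2) ℂ)⁻¹ = -1 := inv_eq_left_inv (by simp)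
  refine list_prod_eq_one_or_neg_one fun a ha => ?_
  obtain ⟨i, rfl⟩ := List.mem_ofFn.mp ha
  have hTi : T i = 1 ∨ T i = -1 := by
    rcases hT i with h | ⟨t, ht, h⟩
    · exact tile_boundary_eq_one_or_neg_one h
    · rcases tile_boundary_eq_one_or_neg_one ht with rfl | rfl
      · exact .inl (by rw [h, inv_one])
      · exact .inr (by rw [h, hinv])
  have hgi := mul_nonsing_inv (g i) (isUnit_det_of_mem_closure (hg i))
  rcases hTi with h | h <;> simp [h, hgi]
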